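/- Let n ≥ 1 and let r, r' ∈ ℝⁿ with r₁ ≥ … ≥ r_n ≥ 0 and r'₁ ≥ … ≥ r'_n ≥ 0. Suppose there exist: a real symmetric 4n×4n matrix Γ, partitioned into 2n×2n blocks Γ = [[Γ₁, Γ₁₂],[Γ₁₂ᵀ, Γ₂]], such that Γ + i·σ_{2n} is positive semidefinite (Γ is the covariance matrix of a Gaussian operation); a real symplectic 2n×2n matrix S; such that, writing Γ̃ := (I_{2n} ⊕ Λ̄) Γ (I_{2n} ⊕ Λ̄) with Λ̄ := ⊕_{k=1}^n Λ, the matrix Γ̃₂ + c(r) is invertible and the following three equations hold: Γ₁ − Γ̃₁₂ (Γ̃₂ + c(r))⁻¹ Γ̃₁₂ᵀ = c(r'), Sᵀ ( c(r) − s(r) (Γ̃₂ + c(r))⁻¹ s(r) ) S = c(r'), and Γ̃₁₂ (Γ̃₂ + c(r))⁻¹ s(r) S = s(r'). Then r_k ≥ r'_k for every k = 1, …, n. (This is the necessity direction of the GLOCC pure-state transformation criterion: a product of two-mode squeezed states with squeezing vector r can be transformed by local Gaussian operations and classical communication into one with vector r' only if r ≥ r' entrywise.) -/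

import Mathlib

open Matrix
open scoped ComplexOrder

/-- The standard symplectic form `σ_m = ⊕_{i=1}^m [[0,-1],[1,0]]` on `ℝ^{2m}`. -/
noncomputable def symp (m : ℕ) : Matrix (Fin (2 * m)) (Fin (2 * m)) ℝ :=
  Matrix.of fun i j =>
    if i.val = j.val + 1 ∧ i.val % 2 = 1 then 1
    else if j.val = i.val + 1 ∧ j.val % 2 = 1 then -1 else 0

/-- `σ_{2m} = σ_m ⊕ σ_m`, the symplectic form on the bipartite `(m + m)`-mode system. -/
noncomputable def sympBig (m : ℕ) :
    Matrix (Fin (2 * m) ⊕ Fin (2 * m)) (Fin (2 * m) ⊕ Fin (2 * m)) ℝ :=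
  Matrix.fromBlocks (symp m) 0 0 (symp m)

/-- `c(r) = ⊕_k cosh(r_k)·I₂`. -/
noncomputable def cmat {n : ℕ} (r : Fin n → ℝ) : Matrix (Fin (2 * n)) (Fin (2 * n)) ℝ :=
  Matrix.diagonal fun i => Real.cosh (r ⟨i.val / 2, by have := i.isLt; omega⟩)

/-- `s(r) = ⊕_k sinh(r_k)·Λ`, `Λ = diag(1,-1)`. -/
noncomputable def smat {n : ℕ} (r : Fin n → ℝ) : Matrix (Fin (2 * n)) (Fin (2 * n)) ℝ :=
  Matrix.diagonal fun i =>
    (if i.val % 2 = 0 then (1 : ℝ) else -1) * Real.sinh (r ⟨i.val / 2, by have := i.isLt; omega⟩)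

/-- `Λ̄ = ⊕_{k=1}^n Λ = diag(1,-1,…,1,-1)`. -/
noncomputable def lambdaBar (n : ℕ) : Matrix (Fin (2 * n)) (Fin (2 * n)) ℝ :=
  Matrix.diagonal fun i => if i.val % 2 = 0 then (1 : ℝ) else -1

def ee0 {n : ℕ} (j : Fin n) : Fin (2 * n) := ⟨2 * j.val, by have := j.isLt; omega⟩
def ee1 {n : ℕ} (j : Fin n) : Fin (2 * n) := ⟨2 * j.val + 1, by have := j.isLt; omega⟩

lemma sum_pair {n : ℕ} (f : Fin (2 * n) → ℝ) :
    ∑ i, f i = ∑ j : Fin n, (f (ee0 j) + f (ee1 j)) := by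
  rw [← Equiv.sum_comp (finProdFinEquiv.trans (finCongr (Nat.mul_comm n 2))) f,
    Fintype.sum_prod_type]
  refine Finset.sum_congr rfl fun j _ => ?_
  rw [Fin.sum_univ_two]
  congr 1 <;> congr 1 <;> apply Fin.ext <;> simp [finProdFinEquiv, ee0, ee1, add_comm]

lemma idx_cases {n : ℕ} (i : Fin (2 * n)) : (∃ j, i = ee0 j) ∨ (∃ j, i = ee1 j) := by
  have := i.isLt
  rcases Nat.even_or_odd' i.val with ⟨c, hc | hc⟩
  · left; exact ⟨⟨c, by omega⟩, Fin.ext hc⟩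
  · right; exact ⟨⟨c, by omega⟩, Fin.ext hc⟩

lemma symp00 {n : ℕ} (j l : Fin n) : symp n (ee0 j) (ee0 l) = 0 := by
  simp only [symp, ee0, Matrix.of_apply]
  rw [if_neg (by omega), if_neg (by omega)]

lemma symp11 {n : ℕ} (j l : Fin n) : symp n (ee1 j) (ee1 l) = 0 := by
  simp only [symp, ee1, Matrix.of_apply]
  rw [if_neg (by omega), if_neg (by omega)]

lemma symp01 {n : ℕ} (j l : Fin n) : symp n (ee0 j) (ee1 l) = if j = l then -1 else 0 := by
  simp only [symp, ee0, ee1, Matrix.of_apply, Fin.ext_iff]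
  rw [if_neg (by omega)]
  by_cases h : j.val = l.val
  · rw [if_pos (by omega), if_pos h]
  · rw [if_neg (by omega), if_neg h]

lemma symp10 {n : ℕ} (j l : Fin n) : symp n (ee1 j) (ee0 l) = if j = l then 1 else 0 := by
  simp only [symp, ee0, ee1, Matrix.of_apply, Fin.ext_iff]
  by_cases h : j.val = l.val
  · rw [if_pos (by omega), if_pos h]
  · rw [if_neg (by omega), if_neg (by omega), if_neg h]

lemma symp_mulVec0 {n : ℕ} (v : Fin (2 * n) → ℝ) (j : Fin n) :
    (symp n *ᵥ v) (ee0 j) = - v (ee1 j) := by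
  simp [Matrix.mulVec, dotProduct, sum_pair, symp00, symp01]

lemma symp_mulVec1 {n : ℕ} (v : Fin (2 * n) → ℝ) (j : Fin n) :
    (symp n *ᵥ v) (ee1 j) = v (ee0 j) := by
  simp [Matrix.mulVec, dotProduct, sum_pair, symp10, symp11]

lemma symp_sq (n : ℕ) : symp n * symp n = -1 := by
  apply Matrix.mulVec_injective
  funext v
  rw [← Matrix.mulVec_mulVec]
  funext i
  rcases idx_cases i with ⟨j, rfl⟩ | ⟨j, rfl⟩
  · simp [symp_mulVec0, symp_mulVec1, Matrix.neg_mulVec]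
  · simp [symp_mulVec0, symp_mulVec1, Matrix.neg_mulVec]

lemma symp_form {n : ℕ} (u v : Fin (2 * n) → ℝ) :
    v ⬝ᵥ (symp n *ᵥ u) = ∑ j : Fin n, (v (ee1 j) * u (ee0 j) - v (ee0 j) * u (ee1 j)) := by
  rw [dotProduct, sum_pair]
  refine Finset.sum_congr rfl fun j _ => ?_
  rw [symp_mulVec0, symp_mulVec1]; ring

lemma cmat_form {n : ℕ} (r : Fin n → ℝ) (u : Fin (2 * n) → ℝ) :
    u ⬝ᵥ (cmat r *ᵥ u) = ∑ j : Fin n, Real.cosh (r j) * (u (ee0 j) ^ 2 + u (ee1 j) ^ 2) := by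
  rw [dotProduct, sum_pair]
  refine Finset.sum_congr rfl fun j _ => ?_
  have h0 : (cmat r *ᵥ u) (ee0 j) = Real.cosh (r j) * u (ee0 j) := by
    rw [cmat, Matrix.mulVec_diagonal]
    congr 3; apply Fin.ext; simp [ee0]
  have h1 : (cmat r *ᵥ u) (ee1 j) = Real.cosh (r j) * u (ee1 j) := by
    rw [cmat, Matrix.mulVec_diagonal]
    congr 3; apply Fin.ext; simp [ee1]; omega
  rw [h0, h1]; ring

/-- The symplectic monotonicity core. -/
lemma core {n : ℕ} (r r' : Fin n → ℝ)
    (hr : ∀ i j : Fin n, i ≤ j → r j ≤ r i) (hr0 : ∀ k, 0 ≤ r k)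
    (hr' : ∀ i j : Fin n, i ≤ j → r' j ≤ r' i) (hr'0 : ∀ k, 0 ≤ r' k)
    (R : Matrix (Fin (2 * n)) (Fin (2 * n)) ℝ)
    (hR : Rᵀ * symp n * R = symp n)
    (hle : ∀ y, (R *ᵥ y) ⬝ᵥ (cmat r' *ᵥ (R *ᵥ y)) ≤ y ⬝ᵥ (cmat r *ᵥ y)) (k : Fin n) :
    r' k ≤ r k := by
  by_contra hlt
  push Not at hlt
  have hab : Real.cosh (r k) < Real.cosh (r' k) := by
    rw [Real.cosh_lt_cosh, abs_of_nonneg (hr0 k), abs_of_nonneg (hr'0 k)]; exact hlt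
  have hbp := Real.cosh_pos (r k)
  -- embeddings
  let m : Fin (2 * n) → Fin n := fun i => ⟨i.val / 2, by have := i.isLt; omega⟩
  have m0 : ∀ j, m (ee0 j) = j := fun j => Fin.ext (by simp [m, ee0])
  have m1 : ∀ j, m (ee1 j) = j := fun j => Fin.ext (by simp [m, ee1]; omega)
  let U : ((Fin n → ℝ) × (Fin n → ℝ)) →ₗ[ℝ] (Fin (2 * n) → ℝ) :=
    { toFun := fun z i => if i.val % 2 = 0 then z.1 (m i) else - z.2 (m i)
      map_add' := by
        intro x y; funext i; simp only [Prod.fst_add, Prod.snd_add, Pi.add_apply]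
        split_ifs <;> ring
      map_smul' := by
        intro c x; funext i
        simp only [Prod.smul_fst, Prod.smul_snd, Pi.smul_apply, smul_eq_mul, RingHom.id_apply]
        split_ifs <;> ring }
  let V : ((Fin n → ℝ) × (Fin n → ℝ)) →ₗ[ℝ] (Fin (2 * n) → ℝ) :=
    { toFun := fun z i => if i.val % 2 = 0 then z.2 (m i) else z.1 (m i)
      map_add' := by
        intro x y; funext i; simp only [Prod.fst_add, Prod.snd_add, Pi.add_apply]
        split_ifs <;> ring
      map_smul' := by
        intro c x; funext i
        simp only [Prod.smul_fst, Prod.smul_snd, Pi.smul_apply, smul_eq_mul, RingHom.id_apply]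
        split_ifs <;> ring }
  have p0 : ∀ j : Fin n, (ee0 j).val % 2 = 0 := fun j => by simp [ee0]
  have p1 : ∀ j : Fin n, ¬ (ee1 j).val % 2 = 0 := fun j => by simp [ee1]
  have U0 : ∀ z j, U z (ee0 j) = z.1 j := fun z j => by
    change (if _ then _ else _) = _
    rw [if_pos (p0 j), m0]
  have U1 : ∀ z j, U z (ee1 j) = - z.2 j := fun z j => by
    change (if _ then _ else _) = _
    rw [if_neg (p1 j), m1]
  have V0 : ∀ z j, V z (ee0 j) = z.2 j := fun z j => by
    change (if _ then _ else _) = _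
    rw [if_pos (p0 j), m0]
  have V1 : ∀ z j, V z (ee1 j) = z.1 j := fun z j => by
    change (if _ then _ else _) = _
    rw [if_neg (p1 j), m1]
  let F : ((Fin n → ℝ) × (Fin n → ℝ)) →ₗ[ℝ] ((Fin n → ℝ) × (Fin n → ℝ)) :=
    { toFun := fun z =>
        (fun j => if j < k then z.1 j else if k < j then
          (R *ᵥ U z) (ee0 j) + (R *ᵥ V z) (ee1 j) else 0,
         fun j => if j < k then z.2 j else if k < j then
          (R *ᵥ V z) (ee0 j) - (R *ᵥ U z) (ee1 j) else 0)
      map_add' := by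
        intro x y
        apply Prod.ext <;> funext j <;>
          simp only [map_add, Matrix.mulVec_add, Prod.fst_add, Prod.snd_add, Pi.add_apply] <;>
          split_ifs <;> ring
      map_smul' := by
        intro c x
        apply Prod.ext <;> funext j <;>
          simp only [map_smul, Matrix.mulVec_smul, Prod.smul_fst, Prod.smul_snd, Pi.smul_apply,
            smul_eq_mul, RingHom.id_apply] <;>
          split_ifs <;> ring }
  have hns : ¬ Function.Surjective F := by
    intro hs
    obtain ⟨z, hz⟩ := hs (fun _ => 1, fun _ => 1)
    have := congrFun (congrArg Prod.fst hz) k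
    simp [F] at this
  have hni : ¬ Function.Injective F := fun h => hns (LinearMap.injective_iff_surjective.mp h)
  rw [← LinearMap.ker_eq_bot] at hni
  obtain ⟨z, hzF, hz0⟩ := Submodule.exists_mem_ne_zero_of_ne_bot hni
  rw [LinearMap.mem_ker] at hzF
  have f1 : ∀ j, (if j < k then z.1 j else if k < j then
          (R *ᵥ U z) (ee0 j) + (R *ᵥ V z) (ee1 j) else 0) = 0 :=
    fun j => congrFun (congrArg Prod.fst hzF) j
  have f2 : ∀ j, (if j < k then z.2 j else if k < j then
          (R *ᵥ V z) (ee0 j) - (R *ᵥ U z) (ee1 j) else 0) = 0 :=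
    fun j => congrFun (congrArg Prod.snd hzF) j
  set T : ℝ := ∑ j, (z.1 j ^ 2 + z.2 j ^ 2) with hT
  have hTpos : 0 < T := by
    rcases lt_or_eq_of_le (show 0 ≤ T from Finset.sum_nonneg fun j _ => by positivity) with h | h
    · exact h
    · exfalso; apply hz0
      have h' := (Finset.sum_eq_zero_iff_of_nonneg (fun j _ => by positivity)).mp h.symm
      apply Prod.ext <;> funext j <;> have := h' j (Finset.mem_univ j) <;>
        simp only [Prod.fst_zero, Prod.snd_zero, Pi.zero_apply] <;> nlinarith [sq_nonneg (z.1 j), sq_nonneg (z.2 j)]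
  -- upper bound
  have hup : U z ⬝ᵥ (cmat r *ᵥ U z) + V z ⬝ᵥ (cmat r *ᵥ V z) ≤ 2 * Real.cosh (r k) * T := by
    rw [cmat_form, cmat_form, ← Finset.sum_add_distrib, hT, Finset.mul_sum]
    refine Finset.sum_le_sum fun j _ => ?_
    rw [U0, U1, V0, V1]
    rcases lt_or_ge j k with h | h
    · have a1 := f1 j
      have a2 := f2 j
      rw [if_pos h] at a1 a2
      simp [a1, a2]
    · have hc : Real.cosh (r j) ≤ Real.cosh (r k) := by
        rw [Real.cosh_le_cosh, abs_of_nonneg (hr0 j), abs_of_nonneg (hr0 k)]; exact hr k j h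
      nlinarith [mul_le_mul_of_nonneg_right hc (show 0 ≤ z.1 j ^ 2 + z.2 j ^ 2 by positivity)]
  have hform : (R *ᵥ V z) ⬝ᵥ (symp n *ᵥ (R *ᵥ U z)) = T := by
    have : (R *ᵥ V z) ⬝ᵥ (symp n *ᵥ (R *ᵥ U z)) = V z ⬝ᵥ ((Rᵀ * symp n * R) *ᵥ U z) := by
      rw [← Matrix.mulVec_mulVec, ← Matrix.mulVec_mulVec, Matrix.dotProduct_mulVec (V z),
        Matrix.vecMul_transpose]
    rw [this, hR, symp_form, hT]
    refine Finset.sum_congr rfl fun j _ => ?_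
    rw [U0, U1, V0, V1]; ring
  have hlow : 2 * Real.cosh (r' k) * T ≤ (R *ᵥ U z) ⬝ᵥ (cmat r' *ᵥ (R *ᵥ U z)) +
      (R *ᵥ V z) ⬝ᵥ (cmat r' *ᵥ (R *ᵥ V z)) := by
    rw [cmat_form, cmat_form, ← Finset.sum_add_distrib, ← hform, symp_form, Finset.mul_sum]
    refine Finset.sum_le_sum fun j _ => ?_
    have a1 := f1 j
    have a2 := f2 j
    generalize (R *ᵥ U z) (ee0 j) = u0 at *
    generalize (R *ᵥ U z) (ee1 j) = u1 at *
    generalize (R *ᵥ V z) (ee0 j) = v0 at *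
    generalize (R *ᵥ V z) (ee1 j) = v1 at *
    have hjp := Real.cosh_pos (r' j)
    have hkp := Real.cosh_pos (r' k)
    rcases lt_or_ge k j with h | h
    · rw [if_neg (not_lt.mpr h.le), if_pos h] at a1 a2
      obtain rfl : v1 = -u0 := by linarith
      obtain rfl : v0 = u1 := by linarith
      have : 0 ≤ Real.cosh (r' k) * (u0 ^ 2 + v0 ^ 2) := by positivity
      have : 0 ≤ Real.cosh (r' j) * (u0 ^ 2 + v0 ^ 2) := by positivity
      nlinarith
    · have hc : Real.cosh (r' k) ≤ Real.cosh (r' j) := by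
        rw [Real.cosh_le_cosh, abs_of_nonneg (hr'0 j), abs_of_nonneg (hr'0 k)]; exact hr' j k h
      have h1 := mul_le_mul_of_nonneg_right hc
        (show 0 ≤ u0 ^ 2 + u1 ^ 2 + (v0 ^ 2 + v1 ^ 2) by positivity)
      have h2 : 0 ≤ Real.cosh (r' k) * ((u0 - v1) ^ 2 + (v0 + u1) ^ 2) := by positivity
      nlinarith
  have e1 := hle (U z)
  have e2 := hle (V z)
  nlinarith

lemma psd22 {n : ℕ}
    (Γ : Matrix (Fin (2 * n) ⊕ Fin (2 * n)) (Fin (2 * n) ⊕ Fin (2 * n)) ℝ)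
    (hΓsym : Γ.IsSymm)
    (hΓpsd : Matrix.PosSemidef
      (Γ.map Complex.ofReal + Complex.I • (sympBig n).map Complex.ofReal)) :
    Γ.PosSemidef := by
  refine Matrix.PosSemidef.of_dotProduct_mulVec_nonneg
    (by rw [Matrix.IsHermitian, Matrix.conjTranspose_eq_transpose_of_trivial]; exact hΓsym) ?_
  intro x
  have h := (Complex.nonneg_iff.mp (hΓpsd.dotProduct_mulVec_nonneg (fun i => (x i : ℂ)))).1
  simpa [dotProduct, Matrix.mulVec, Complex.re_sum, Complex.im_sum] using h

/-- **Necessity of entrywise domination for GLOCC pure-state transformations.**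
If a Gaussian local operation with CM `Γ` (real symmetric, `Γ + iσ_{2n} ≥ 0`) applied to
the `A`-side of a product of two-mode squeezed states with ordered squeezing vector `r`,
followed by a symplectic `S` on the `B` side, produces the product of two-mode squeezed
states with ordered squeezing vector `r'` (the three block equations below), then
`r_k ≥ r'_k` for all `k`. -/
theorem glocc_necessity (n : ℕ) (hn : 1 ≤ n) (r r' : Fin n → ℝ)
    (hr : ∀ i j : Fin n, i ≤ j → r j ≤ r i) (hr0 : ∀ k, 0 ≤ r k)
    (hr' : ∀ i j : Fin n, i ≤ j → r' j ≤ r' i) (hr'0 : ∀ k, 0 ≤ r' k)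
    (Γ : Matrix (Fin (2 * n) ⊕ Fin (2 * n)) (Fin (2 * n) ⊕ Fin (2 * n)) ℝ)
    (hΓsym : Γ.IsSymm)
    (hΓpsd : Matrix.PosSemidef
      (Γ.map Complex.ofReal + Complex.I • (sympBig n).map Complex.ofReal))
    (S : Matrix (Fin (2 * n)) (Fin (2 * n)) ℝ)
    (hS : S * symp n * Sᵀ = symp n)
    (Γt : Matrix (Fin (2 * n) ⊕ Fin (2 * n)) (Fin (2 * n) ⊕ Fin (2 * n)) ℝ)
    (hΓt : Γt = (Matrix.fromBlocks 1 0 0 (lambdaBar n)) * Γ *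
      (Matrix.fromBlocks 1 0 0 (lambdaBar n)))
    (hinv : IsUnit (Γt.toBlocks₂₂ + cmat r))
    (heqA : Γ.toBlocks₁₁ -
      Γt.toBlocks₁₂ * (Γt.toBlocks₂₂ + cmat r)⁻¹ * (Γt.toBlocks₁₂)ᵀ = cmat r')
    (heqB : Sᵀ * (cmat r - smat r * (Γt.toBlocks₂₂ + cmat r)⁻¹ * smat r) * S = cmat r')
    (heqC : Γt.toBlocks₁₂ * (Γt.toBlocks₂₂ + cmat r)⁻¹ * smat r * S = smat r') :
    ∀ k, r' k ≤ r k := by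
  have hΓ : Γ.PosSemidef := psd22 Γ hΓsym hΓpsd
  have hL : (Matrix.fromBlocks 1 0 0 (lambdaBar n) :
      Matrix (Fin (2 * n) ⊕ Fin (2 * n)) (Fin (2 * n) ⊕ Fin (2 * n)) ℝ)ᴴ =
      Matrix.fromBlocks 1 0 0 (lambdaBar n) := by
    simp [Matrix.fromBlocks_transpose, lambdaBar]
  have hΓt' : Γt.PosSemidef := by
    have := hΓ.mul_mul_conjTranspose_same (Matrix.fromBlocks 1 0 0 (lambdaBar n) :
      Matrix (Fin (2 * n) ⊕ Fin (2 * n)) (Fin (2 * n) ⊕ Fin (2 * n)) ℝ)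
    rw [hL] at this
    rw [hΓt]; exact this
  have h22 : (Γt.toBlocks₂₂).PosSemidef := hΓt'.submatrix Sum.inr
  have hc : (cmat r).PosSemidef :=
    Matrix.PosSemidef.diagonal fun i => (Real.cosh_pos _).le
  have hM : ((Γt.toBlocks₂₂ + cmat r)⁻¹).PosSemidef := (h22.add hc).inv
  generalize (Γt.toBlocks₂₂ + cmat r)⁻¹ = N at *
  -- inverse of S
  have h1 : S * (symp n * Sᵀ * (-symp n)) = 1 := by
    rw [← Matrix.mul_assoc, ← Matrix.mul_assoc, hS, Matrix.mul_neg, symp_sq, neg_neg]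
  have h2 := mul_eq_one_comm.mp h1
  have hSS : Sᵀ * symp n * S = symp n := by
    have h3 := congrArg (fun X => symp n * X) h2
    simp only [← Matrix.mul_assoc, symp_sq, Matrix.mul_neg, Matrix.neg_mul, Matrix.one_mul,
      Matrix.mul_one, neg_neg] at h3
    exact h3
  set R := symp n * Sᵀ * (-symp n) with hRdef
  clear_value R
  have hRR : Rᵀ * symp n * R = symp n := by
    have hT1 : Rᵀ * Sᵀ = 1 := by rw [← Matrix.transpose_mul, h1, Matrix.transpose_one]
    calc Rᵀ * symp n * R = Rᵀ * (Sᵀ * symp n * S) * R := by rw [hSS]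
      _ = (Rᵀ * Sᵀ) * symp n * (S * R) := by simp only [Matrix.mul_assoc]
      _ = symp n := by rw [hT1, h1, Matrix.one_mul, Matrix.mul_one]
  refine core r r' hr hr0 hr' hr'0 R hRR ?_
  intro y
  have hy : S *ᵥ (R *ᵥ y) = y := by rw [Matrix.mulVec_mulVec, h1, Matrix.one_mulVec]
  have hs : (smat r)ᵀ = smat r := by simp [smat]
  have key : (R *ᵥ y) ⬝ᵥ (cmat r' *ᵥ (R *ᵥ y)) =
      y ⬝ᵥ (cmat r *ᵥ y) - (smat r *ᵥ y) ⬝ᵥ (N *ᵥ (smat r *ᵥ y)) := by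
    rw [← heqB, ← Matrix.mulVec_mulVec, ← Matrix.mulVec_mulVec, hy,
      Matrix.dotProduct_mulVec (R *ᵥ y), Matrix.vecMul_transpose, hy, Matrix.sub_mulVec,
      dotProduct_sub, ← Matrix.mulVec_mulVec, ← Matrix.mulVec_mulVec,
      Matrix.dotProduct_mulVec y (smat r), ← hs, Matrix.vecMul_transpose, hs]
  have hN := hM.dotProduct_mulVec_nonneg (smat r *ᵥ y)
  rw [star_trivial] at hN
  rw [key]; linarith
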